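/- Let k be a field with char k ≠ 2, and l, l' quadratic field extensions of k generated by square roots of α and β respectively. Then for any α, β non-squares in k over a field with at least 3 elements, there exists q ∈ k with q² ≠ 4αβ, and for such q the algebra C_q = k⟨x,y⟩/(x²−α, y²−β, xy+yx−q) is a central simple k-algebra of dimension 4. -/

import Mathlib

open FreeAlgebra

/-- Relations for `C_q = k⟨x,y⟩/(x² − α, y² − β, xy + yx − q)`. -/
inductive CRel (k : Type*) [Field k] (α β q : k) :
    FreeAlgebra k (Fin 2) → FreeAlgebra k (Fin 2) → Prop
  | xx : CRel k α β q (ι k 0 * ι k 0) (algebraMap k _ α)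
  | yy : CRel k α β q (ι k 1 * ι k 1) (algebraMap k _ β)
  | mix : CRel k α β q (ι k 0 * ι k 1 + ι k 1 * ι k 0) (algebraMap k _ q)

open Quaternion in
theorem quat_simple {k : Type*} [Field k] (h2 : (2 : k) ≠ 0) (a c : k) (ha : a ≠ 0) (hc : c ≠ 0) :
    IsSimpleRing ℍ[k,a,0,c] := by
  have h4 : (4 : k) ≠ 0 := by
    have : (4 : k) = 2 * 2 := by norm_num
    rw [this]; exact mul_ne_zero h2 h2
  refine .of_eq_bot_or_eq_top fun I => ?_
  rw [or_iff_not_imp_left, ← I.one_mem_iff]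
  intro H
  obtain ⟨z, hz, hz0⟩ := SetLike.exists_of_lt (bot_lt_iff_ne_bot.mpr H : ⊥ < I)
  have hz0 : z ≠ 0 := hz0
  have key : ∀ w : ℍ[k,a,0,c], w ∈ I → w.re ≠ 0 → (1 : ℍ[k,a,0,c]) ∈ I := by
    intro w hw hr
    have e : (1 : ℍ[k,a,0,c]) = (⟨(4 * a * c * w.re)⁻¹, 0, 0, 0⟩ : ℍ[k,a,0,c]) *
        ((⟨a * c, 0, 0, 0⟩ : ℍ[k,a,0,c]) * w
          + (⟨0, c, 0, 0⟩ : ℍ[k,a,0,c]) * w * (⟨0, 1, 0, 0⟩ : ℍ[k,a,0,c])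
          + (⟨0, 0, a, 0⟩ : ℍ[k,a,0,c]) * w * (⟨0, 0, 1, 0⟩ : ℍ[k,a,0,c])
          + (⟨0, 0, 0, -1⟩ : ℍ[k,a,0,c]) * w * (⟨0, 0, 0, 1⟩ : ℍ[k,a,0,c])) := by
      ext
      · simp
        field_simp
        ring
      all_goals
        simp
        try ring_nf
        try simp
    rw [e]
    refine I.mul_mem_left _ _ (I.add_mem (I.add_mem (I.add_mem ?_ ?_) ?_) ?_)
    · exact I.mul_mem_left _ _ hw
    all_goals exact I.mul_mem_right _ _ (I.mul_mem_left _ _ hw)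
  by_cases h0 : z.re = 0
  swap
  · exact key z hz h0
  by_cases h1 : z.imI = 0
  swap
  · refine key (z * ⟨0, 1, 0, 0⟩) (I.mul_mem_right _ _ hz) ?_
    simp [ha, h1]
  by_cases h2 : z.imJ = 0
  swap
  · refine key (z * ⟨0, 0, 1, 0⟩) (I.mul_mem_right _ _ hz) ?_
    simp [hc, h2]
  by_cases h3 : z.imK = 0
  swap
  · refine key (z * ⟨0, 0, 0, 1⟩) (I.mul_mem_right _ _ hz) ?_
    simp [ha, hc, h3]
  exact absurd (QuaternionAlgebra.ext h0 h1 h2 h3) hz0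

open Quaternion in
theorem quat_central {k : Type*} [Field k] (h2 : (2 : k) ≠ 0) (a c : k) (ha : a ≠ 0) (hc : c ≠ 0) :
    Algebra.IsCentral k ℍ[k,a,0,c] := by
  refine ⟨fun z hz => ?_⟩
  rw [Subalgebra.mem_center_iff] at hz
  have hi := hz ⟨0, 1, 0, 0⟩
  have hj := hz ⟨0, 0, 1, 0⟩
  have i2 := congrArg QuaternionAlgebra.imJ hi
  have i3 := congrArg QuaternionAlgebra.imK hi
  have j3 := congrArg QuaternionAlgebra.imK hj
  simp at i2 i3 j3
  have e1 : z.imI = 0 := by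
    have : 2 * z.imI = 0 := by linear_combination -j3
    simpa [h2] using this
  have e2 : z.imJ = 0 := by
    have : 2 * z.imJ = 0 := by linear_combination i3
    simpa [h2] using this
  have e3 : z.imK = 0 := by
    have : (2 * a) * z.imK = 0 := by linear_combination i2
    simpa [h2, ha] using this
  rw [Algebra.mem_bot]
  refine ⟨z.re, ?_⟩
  ext <;> simp [e1, e2, e3]

open Quaternion in
/-- The quaternion basis attached to a pair of elements satisfying the relations of `C_q`. -/
def cBasis {k A : Type*} [Field k] [Ring A] [Algebra k A] (h2 : (2 : k) ≠ 0) (α β q : k)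
    (ha : α ≠ 0) (x y : A) (hx : x * x = algebraMap k A α) (hy : y * y = algebraMap k A β)
    (hxy : x * y + y * x = algebraMap k A q) :
    QuaternionAlgebra.Basis A α 0 (β - q ^ 2 / (4 * α)) where
  i := x
  j := y - (q / (2 * α)) • x
  k := x * (y - (q / (2 * α)) • x)
  i_mul_i := by simp [hx, Algebra.algebraMap_eq_smul_one]
  j_mul_j := by
    have h : (y - (q / (2 * α)) • x) * (y - (q / (2 * α)) • x)
      = y * y - (q / (2 * α)) • (x * y + y * x) + ((q / (2 * α)) * (q / (2 * α))) • (x * x) := by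
      simp only [sub_mul, mul_sub, smul_mul_assoc, mul_smul_comm, smul_add, smul_sub, mul_smul]
      abel
    rw [h, hx, hy, hxy]
    simp only [Algebra.algebraMap_eq_smul_one, smul_smul, ← sub_smul, ← add_smul]
    congr 1
    have h4 : (4 : k) = 2 * 2 := by norm_num
    rw [h4]
    field_simp
    ring
  i_mul_j := rfl
  j_mul_i := by
    have h : y * x = algebraMap k A q - x * y := by rw [← hxy]; abel
    simp only [sub_mul, mul_sub, smul_mul_assoc, mul_smul_comm, h, hx, zero_smul]
    simp only [Algebra.algebraMap_eq_smul_one, smul_smul]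
    have : q / (2 * α) * α = q / 2 := by field_simp
    rw [this]
    have h3 : q • (1 : A) = (q / 2) • (1 : A) + (q / 2) • (1 : A) := by
      rw [← add_smul]; congr 1; field_simp; ring
    rw [h3]; abel

open Quaternion in
theorem c_equiv {k : Type*} [Field k] (h2 : (2 : k) ≠ 0) (α β q : k) (ha : α ≠ 0) :
    Nonempty (ℍ[k,α,0,β - q ^ 2 / (4 * α)] ≃ₐ[k] RingQuot (CRel k α β q)) := by
  have h4 : (4 : k) = 2 * 2 := by norm_num
  let X : ℍ[k,α,0,β - q ^ 2 / (4 * α)] := ⟨0, 1, 0, 0⟩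
  let Y : ℍ[k,α,0,β - q ^ 2 / (4 * α)] := ⟨0, q / (2 * α), 1, 0⟩
  let f0 : FreeAlgebra k (Fin 2) →ₐ[k] ℍ[k,α,0,β - q ^ 2 / (4 * α)] := FreeAlgebra.lift k ![X, Y]
  have hf0 : f0 (ι k 0) = X := by simp [f0]
  have hf1 : f0 (ι k 1) = Y := by simp [f0]
  have hf : ∀ ⦃u v⦄, CRel k α β q u v → f0 u = f0 v := by
    intro u v h
    cases h
    · rw [map_mul, hf0, AlgHom.commutes]
      ext <;> simp [X]
    · rw [map_mul, hf1, AlgHom.commutes]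
      ext <;> simp [Y]
      rw [h4]; field_simp; ring
    · rw [map_add, map_mul, map_mul, hf0, hf1, AlgHom.commutes]
      ext <;> simp [X, Y]
      field_simp; ring
  let f : RingQuot (CRel k α β q) →ₐ[k] ℍ[k,α,0,β - q ^ 2 / (4 * α)] := RingQuot.liftAlgHom k ⟨f0, hf⟩
  let m := RingQuot.mkAlgHom k (CRel k α β q)
  have hfm : ∀ u, f (m u) = f0 u := fun u => RingQuot.liftAlgHom_mkAlgHom_apply k f0 hf u
  let b := cBasis h2 α β q ha (m (ι k 0)) (m (ι k 1))
    (by rw [← map_mul, ← AlgHom.commutes m]; exact RingQuot.mkAlgHom_rel k CRel.xx)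
    (by rw [← map_mul, ← AlgHom.commutes m]; exact RingQuot.mkAlgHom_rel k CRel.yy)
    (by rw [← map_mul, ← map_mul, ← map_add, ← AlgHom.commutes m]
        exact RingQuot.mkAlgHom_rel k CRel.mix)
  let g : ℍ[k,α,0,β - q ^ 2 / (4 * α)] →ₐ[k] RingQuot (CRel k α β q) := b.liftHom
  have hbi : b.i = m (ι k 0) := rfl
  have hbj : b.j = m (ι k 1) - (q / (2 * α)) • m (ι k 0) := rfl
  have hgX : g X = m (ι k 0) := by
    simp [g, X, QuaternionAlgebra.Basis.lift, hbi]
  have hgY : g Y = m (ι k 1) := by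
    simp [g, Y, QuaternionAlgebra.Basis.lift, hbi, hbj]
  refine ⟨AlgEquiv.ofAlgHom g f ?_ ?_⟩
  · apply RingQuot.ringQuot_ext'
    apply FreeAlgebra.hom_ext
    funext i
    fin_cases i
    · change g (f (m (ι k 0))) = m (ι k 0)
      rw [hfm, hf0, hgX]
    · change g (f (m (ι k 1))) = m (ι k 1)
      rw [hfm, hf1, hgY]
  · apply QuaternionAlgebra.hom_ext
    · change f (g X) = X
      rw [hgX, hfm, hf0]
    · change f (g ⟨0, 0, 1, 0⟩) = (⟨0, 0, 1, 0⟩ : ℍ[k,α,0,β - q ^ 2 / (4 * α)])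
      have : (⟨0, 0, 1, 0⟩ : ℍ[k,α,0,β - q ^ 2 / (4 * α)]) = Y - (q / (2 * α)) • X := by
        ext <;> simp [X, Y]
      rw [this, map_sub, map_smul, hgX, hgY, map_sub, map_smul, hfm, hfm, hf0, hf1]

/-- Over a field `k` of characteristic ≠ 2 with at least 3 elements, for `α, β` non-squares,
there exists `q ∈ k` with `q² ≠ 4αβ`, and for every such `q` the algebra
`C_q = k⟨x,y⟩/(x² − α, y² − β, xy + yx − q)` is a central simple `k`-algebra of dimension 4. -/
theorem stmt19 {k : Type*} [Field k] (h2 : (2 : k) ≠ 0)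
    (hcard : 3 ≤ Nat.card k ∨ Infinite k) (α β : k)
    (hα : ∀ c : k, c ^ 2 ≠ α) (hβ : ∀ c : k, c ^ 2 ≠ β) :
    (∃ q : k, q ^ 2 ≠ 4 * α * β) ∧
      ∀ q : k, q ^ 2 ≠ 4 * α * β →
        Algebra.IsCentral k (RingQuot (CRel k α β q)) ∧
        IsSimpleRing (RingQuot (CRel k α β q)) ∧
        Module.finrank k (RingQuot (CRel k α β q)) = 4 := by
  have ha : α ≠ 0 := fun h => hα 0 (by simp [h])
  have hb : β ≠ 0 := fun h => hβ 0 (by simp [h])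
  have h4 : (4 : k) ≠ 0 := by
    have : (4 : k) = 2 * 2 := by norm_num
    rw [this]; exact mul_ne_zero h2 h2
  refine ⟨⟨0, ?_⟩, fun q hq => ?_⟩
  · intro h
    have : 4 * α * β ≠ 0 := mul_ne_zero (mul_ne_zero h4 ha) hb
    exact this (by rw [← h]; simp)
  · have hc : β - q ^ 2 / (4 * α) ≠ 0 := by
      intro h
      apply hq
      field_simp at h
      linear_combination -h
    obtain ⟨e⟩ := c_equiv h2 α β q ha
    have := quat_central h2 α _ ha hc
    refine ⟨Algebra.IsCentral.of_algEquiv k _ _ e,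
      IsSimpleRing.of_ringEquiv e.toRingEquiv (quat_simple h2 α _ ha hc), ?_⟩
    rw [← e.toLinearEquiv.finrank_eq]
    exact QuaternionAlgebra.finrank_eq_four _ _ _
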